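/- Let Z be a real normed space, U a metric space (or normed space), M ⊆ Z a nonempty set, D : Z → U Lipschitz with constant K > 0, f : U → ℝ Lipschitz with constant L > 0, and γ > 0 with f(D(z*)) ≤ −γ for every z* ∈ M. Set δ_feas = γ/(L·K). Let (z_t)_{t≥0} be a sequence in Z such that for every t, infDist(z_t, M) ≤ δ_feas/2 and ‖z_{t+1} − z_t‖ ≤ δ_feas/2. Then f(D(z_{t+1})) ≤ 0 for every t ≥ 0. -/

import Mathlib

/-- A function that is Lipschitz with constant `C > 0` and at most `c` on `M` exceeds `c` by at most
`C` times the distance to `M`. -/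
theorem le_add_mul_infDist {X : Type*} [PseudoMetricSpace X] {M : Set X} (hM : M.Nonempty)
    {g : X → ℝ} {C c : ℝ} (hC : 0 < C) (hg : ∀ x y, g x - g y ≤ C * dist x y)
    (hgM : ∀ y ∈ M, g y ≤ c) (x : X) : g x ≤ c + C * Metric.infDist x M := by
  have h : (g x - c) / C ≤ Metric.infDist x M := by
    refine (Metric.le_infDist hM).2 fun {y} hy => ?_
    rw [div_le_iff₀' hC]
    linarith [hg x y, hgM y hy]
  rw [div_le_iff₀' hC] at h
  linarith

/-- Per-cycle feasibility: with feasibility radius `δ_feas = γ/(L·K)`, if at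
each cycle the latent state is localized within `δ_feas/2` of the manifold
and the step size is capped at `δ_feas/2`, then every decoded action is
feasible. -/
theorem per_cycle_feasibility
    {Z U : Type*} [NormedAddCommGroup Z] [NormedSpace ℝ Z] [MetricSpace U]
    (M : Set Z) (hM : M.Nonempty)
    (D : Z → U) (f : U → ℝ) (K L γ : ℝ)
    (hK : 0 < K) (hL : 0 < L) (hγ : 0 < γ)
    (hDLip : ∀ z z' : Z, dist (D z) (D z') ≤ K * ‖z - z'‖)
    (hfLip : ∀ u u' : U, |f u - f u'| ≤ L * dist u u')
    (hfeas : ∀ zstar ∈ M, f (D zstar) ≤ -γ)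
    (z : ℕ → Z)
    (hloc : ∀ t, Metric.infDist (z t) M ≤ γ / (L * K) / 2)
    (hcap : ∀ t, ‖z (t + 1) - z t‖ ≤ γ / (L * K) / 2) :
    ∀ t : ℕ, f (D (z (t + 1))) ≤ 0 := by
  intro t
  have hLK : 0 < L * K := mul_pos hL hK
  have hcomp : ∀ x y, f (D x) - f (D y) ≤ L * K * dist x y := fun x y =>
    calc f (D x) - f (D y) ≤ L * dist (D x) (D y) := (le_abs_self _).trans (hfLip _ _)
      _ ≤ L * (K * ‖x - y‖) := mul_le_mul_of_nonneg_left (hDLip x y) hL.le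
      _ = L * K * dist x y := by rw [dist_eq_norm, mul_assoc]
  have hdist : Metric.infDist (z (t + 1)) M ≤ γ / (L * K) := by
    have h := Metric.infDist_le_infDist_add_dist (s := M) (x := z (t + 1)) (y := z t)
    rw [dist_eq_norm] at h
    linarith [hloc t, hcap t]
  rw [le_div_iff₀' hLK] at hdist
  linarith [le_add_mul_infDist (g := fun x => f (D x)) hM hLK hcomp hfeas (z (t + 1))]
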